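/- arXiv:2206.08736 — 7 statements merged into one kernel-verified Lean document; each statement's English description precedes it below -/
import Mathlib

section
/- Generalised policy improvement (GPI). Let a finite MDP with discount factor γ ∈ [0,1) be given, let π₁,…,πₙ be Markov policies with Q-functions Q^{π₁}_γ,…,Q^{πₙ}_γ, and let π' be a Markov policy that is greedy with respect to the family {Q^{π₁}_γ,…,Q^{πₙ}_γ}. Then Q^{π'}_γ(x,a) ≥ max_{1≤i≤n} Q^{πᵢ}_γ(x,a) for every state-action pair (x,a). Moreover, if equality holds at every state-action pair, then π' is optimal, i.e. Q^{π'}_γ(x,a) ≥ Q^{π}_γ(x,a) for every Markov policy π and every (x,a). -/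
open scoped BigOperators

theorem gpi_compare {X A : Type} [Fintype X] [Fintype A] [Nonempty X] [Nonempty A]
    (P : X → A → X → ℝ) (hP0 : ∀ x a x', 0 ≤ P x a x')
    (hP1 : ∀ x a, ∑ x', P x a x' = 1)
    (r : X → A → ℝ) (γ : ℝ) (hγ0 : 0 ≤ γ) (hγ1 : γ < 1)
    (w : X → A → ℝ) (hw0 : ∀ x a, 0 ≤ w x a) (hw1 : ∀ x, ∑ a, w x a = 1)
    (U V : X → A → ℝ)
    (hU : ∀ x a, U x a ≤ r x a + γ * ∑ x', P x a x' * ∑ a', w x' a' * U x' a')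
    (hV : ∀ x a, r x a + γ * ∑ x', P x a x' * ∑ a', w x' a' * V x' a' ≤ V x a) :
    ∀ x a, U x a ≤ V x a := by
  obtain ⟨p, hp⟩ := Finite.exists_max (fun p : X × A => U p.1 p.2 - V p.1 p.2)
  set m := U p.1 p.2 - V p.1 p.2 with hm
  have hle : ∀ x a, U x a ≤ V x a + m := fun x a => by
    have := hp (x, a)
    simp only at this
    linarith
  have h1 : ∀ x, ∑ a, w x a * U x a ≤ ∑ a, w x a * V x a + m := fun x => by
    calc ∑ a, w x a * U x a ≤ ∑ a, (w x a * V x a + w x a * m) :=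
          Finset.sum_le_sum fun a _ => by
            have := mul_le_mul_of_nonneg_left (hle x a) (hw0 x a)
            linarith
      _ = _ := by rw [Finset.sum_add_distrib, ← Finset.sum_mul, hw1, one_mul]
  have h2 : ∀ x a, ∑ x', P x a x' * ∑ a', w x' a' * U x' a' ≤
      ∑ x', P x a x' * ∑ a', w x' a' * V x' a' + m := fun x a => by
    calc ∑ x', P x a x' * ∑ a', w x' a' * U x' a'
        ≤ ∑ x', (P x a x' * ∑ a', w x' a' * V x' a' + P x a x' * m) :=
          Finset.sum_le_sum fun x' _ => by
            have := mul_le_mul_of_nonneg_left (h1 x') (hP0 x a x')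
            linarith
      _ = _ := by rw [Finset.sum_add_distrib, ← Finset.sum_mul, hP1, one_mul]
  have h3 := mul_le_mul_of_nonneg_left (h2 p.1 p.2) hγ0
  have h4 : m ≤ γ * m := by
    have := hU p.1 p.2
    have := hV p.1 p.2
    linarith
  have h5 : m ≤ 0 := by nlinarith
  intro x a
  linarith [hle x a]

/-- **Generalised policy improvement (GPI).**
Given a finite MDP with discount `γ ∈ [0,1)`, Markov policies `π 1, …, π n` with
Q-functions `Q i` (each characterised as the unique fixed point of its Bellman operator),
and a Markov policy `π'` that is greedy with respect to the family `{Q i}`, we have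
`Q^{π'} ≥ max_i Q i` pointwise; and if equality holds everywhere then `π'` is optimal,
i.e. `Q^{π'} ≥ Q^π` for every Markov policy `π`. -/
theorem generalised_policy_improvement
    {X A : Type} [Fintype X] [Fintype A] [Nonempty X] [Nonempty A]
    (P : X → A → X → ℝ) (hP0 : ∀ x a x', 0 ≤ P x a x')
    (hP1 : ∀ x a, ∑ x', P x a x' = 1)
    (r : X → A → ℝ) (γ : ℝ) (hγ0 : 0 ≤ γ) (hγ1 : γ < 1)
    (n : ℕ) (hn : 0 < n)
    (π : Fin n → X → A → ℝ)
    (hπ0 : ∀ i x a, 0 ≤ π i x a) (hπ1 : ∀ i x, ∑ a, π i x a = 1)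
    (Q : Fin n → X → A → ℝ)
    (hQ : ∀ i x a, Q i x a =
      r x a + γ * ∑ x', P x a x' * ∑ a', π i x' a' * Q i x' a')
    (π' : X → A → ℝ) (hπ'0 : ∀ x a, 0 ≤ π' x a) (hπ'1 : ∀ x, ∑ a, π' x a = 1)
    (hgreedy : ∀ x a, 0 < π' x a → ∀ a', (⨆ i, Q i x a') ≤ ⨆ i, Q i x a)
    (Q' : X → A → ℝ)
    (hQ' : ∀ x a, Q' x a =
      r x a + γ * ∑ x', P x a x' * ∑ a', π' x' a' * Q' x' a') :
    (∀ x a, (⨆ i, Q i x a) ≤ Q' x a) ∧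
    ((∀ x a, Q' x a = ⨆ i, Q i x a) →
      ∀ (σ : X → A → ℝ), (∀ x a, 0 ≤ σ x a) → (∀ x, ∑ a, σ x a = 1) →
        ∀ (Qσ : X → A → ℝ),
          (∀ x a, Qσ x a =
            r x a + γ * ∑ x', P x a x' * ∑ a', σ x' a' * Qσ x' a') →
          ∀ x a, Qσ x a ≤ Q' x a) := by
  haveI : Nonempty (Fin n) := ⟨⟨0, hn⟩⟩
  have key : ∀ (σ : X → A → ℝ), (∀ x a, 0 ≤ σ x a) → (∀ x, ∑ a, σ x a = 1) → ∀ x,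
      ∑ a, σ x a * (⨆ i, Q i x a) ≤ ∑ a, π' x a * (⨆ i, Q i x a) := by
    intro σ hσ0 hσ1 x
    obtain ⟨c, -, hc⟩ : ∃ c ∈ Finset.univ, 0 < π' x c := by
      apply Finset.exists_lt_of_sum_lt
      simp [hπ'1]
    calc ∑ a, σ x a * (⨆ i, Q i x a) ≤ ∑ a, σ x a * (⨆ i, Q i x c) :=
          Finset.sum_le_sum fun a _ => mul_le_mul_of_nonneg_left (hgreedy x c hc a) (hσ0 x a)
      _ = ∑ a, π' x a * (⨆ i, Q i x c) := by
          rw [← Finset.sum_mul, ← Finset.sum_mul, hσ1, hπ'1]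
      _ ≤ _ := Finset.sum_le_sum fun a _ => by
          rcases (hπ'0 x a).eq_or_lt with h | h
          · simp [← h]
          · exact mul_le_mul_of_nonneg_left (hgreedy x a h c) h.le
  have back : ∀ (σ : X → A → ℝ), (∀ x a, 0 ≤ σ x a) → (∀ x, ∑ a, σ x a = 1) → ∀ x a,
      r x a + γ * ∑ x', P x a x' * ∑ a', σ x' a' * (⨆ i, Q i x' a') ≤
      r x a + γ * ∑ x', P x a x' * ∑ a', π' x' a' * (⨆ i, Q i x' a') := by
    intro σ hσ0 hσ1 x a
    have := mul_le_mul_of_nonneg_left (Finset.sum_le_sum fun x' (_ : x' ∈ Finset.univ) =>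
      mul_le_mul_of_nonneg_left (key σ hσ0 hσ1 x') (hP0 x a x')) hγ0
    linarith
  constructor
  · refine gpi_compare P hP0 hP1 r γ hγ0 hγ1 π' hπ'0 hπ'1 (fun x a => ⨆ i, Q i x a) Q' ?_
      (fun x a => (hQ' x a).ge)
    intro x a
    refine ciSup_le fun i => ?_
    refine le_trans ?_ (back (π i) (hπ0 i) (hπ1 i) x a)
    rw [hQ i x a]
    have := mul_le_mul_of_nonneg_left (Finset.sum_le_sum fun x' (_ : x' ∈ Finset.univ) =>
      mul_le_mul_of_nonneg_left (Finset.sum_le_sum fun a' (_ : a' ∈ Finset.univ) =>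
        mul_le_mul_of_nonneg_left (le_ciSup (Set.finite_range fun j => Q j x' a').bddAbove i)
          (hπ0 i x' a')) (hP0 x a x')) hγ0
    linarith
  · intro heq σ hσ0 hσ1 Qσ hQσ
    refine gpi_compare P hP0 hP1 r γ hγ0 hγ1 σ hσ0 hσ1 Qσ Q' (fun x a => (hQσ x a).le) ?_
    intro x a
    rw [hQ' x a]
    simp only [heq]
    exact back σ hσ0 hσ1 x a
end

section
/- Composed-model evaluation of a Markov policy. Let a finite MDP with discount factor γ ∈ (0,1) be given, let π be a Markov policy, let n ≥ 1, and let 0 ≤ β < γ. Define a joint distribution over (X^{(1)},A^{(1)},…,X^{(n-1)},A^{(n-1)},X') by: (X^{(0)},A^{(0)}) = (x,a); for m = 1,…,n-1, X^{(m)} given (X^{(m-1)},A^{(m-1)}) has law μ^π_β(·|X^{(m-1)},A^{(m-1)}) and A^{(m)} given X^{(m)} has law π(·|X^{(m)}); and X' given (X^{(n-1)},A^{(n-1)}) has law μ^π_γ(·|X^{(n-1)},A^{(n-1)}). Then Q^π_γ(x,a) = r(x,a) + (γ/(1-γ)) [ ∑_{m=1}^{n-1} ((1-γ)/(1-β)) ((γ-β)/(1-β))^{m-1}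 E[r^π(X^{(m)})] + ((γ-β)/(1-β))^{n-1} E[r^π(X')] ], where r^π(x) = ∑_{a} π(a|x) r(x,a) and all expectations are finite sums over the joint distribution. -/
open scoped BigOperators

/-- The state-action transition matrix `S^π((x,a),(x',a')) = P(x'|x,a) π(a'|x')`. -/
def stateActionMatrix {X A : Type} [Fintype X] [Fintype A]
    (P : X → A → X → ℝ) (π : X → A → ℝ) : Matrix (X × A) (X × A) ℝ :=
  Matrix.of fun p q => P p.1 p.2 q.1 * π q.1 q.2

/-- The discounted future state-visitation distribution
`μ^π_β(x'|x,a) = (1-β) ∑_{k≥0} β^k ∑_{a'} (S^π)^{k+1}((x,a),(x',a'))`. -/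
noncomputable def visit {X A : Type} [Fintype X] [Fintype A] [DecidableEq X] [DecidableEq A]
    (P : X → A → X → ℝ) (π : X → A → ℝ) (β : ℝ) (x : X) (a : A) (x' : X) : ℝ :=
  (1 - β) * ∑' k : ℕ, β ^ k * ∑ a' : A, (stateActionMatrix P π ^ (k + 1)) (x, a) (x', a')

/-- The one-step kernel of the Markov chain on state-action pairs whose state marginal
transitions according to `μ^π_β` and whose action is then drawn from `π`:
`K((x,a),(x',a')) = μ^π_β(x'|x,a) π(a'|x')`.  The law of `(X^{(m)}, A^{(m)})` in the
composed-model sampling procedure started from `(x,a)` is the `(x,a)`-row of `K^m`. -/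
noncomputable def ghmKernel {X A : Type} [Fintype X] [Fintype A] [DecidableEq X] [DecidableEq A]
    (P : X → A → X → ℝ) (π : X → A → ℝ) (β : ℝ) : Matrix (X × A) (X × A) ℝ :=
  Matrix.of fun p q => visit P π β p.1 p.2 q.1 * π q.1 q.2

lemma sam_mem {X A : Type} [Fintype X] [Fintype A] [DecidableEq X] [DecidableEq A]
    (P : X → A → X → ℝ) (hP0 : ∀ x a x', 0 ≤ P x a x')
    (hP1 : ∀ x a, ∑ x', P x a x' = 1)
    (π : X → A → ℝ) (hπ0 : ∀ x a, 0 ≤ π x a) (hπ1 : ∀ x, ∑ a, π x a = 1) :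
    stateActionMatrix P π ∈ Matrix.rowStochastic ℝ (X × A) := by
  rw [Matrix.mem_rowStochastic_iff_sum]
  refine ⟨fun i j => mul_nonneg (hP0 _ _ _) (hπ0 _ _), fun i => ?_⟩
  simp [stateActionMatrix, Fintype.sum_prod_type, ← Finset.mul_sum, hπ1, hP1]

lemma stoch_inj {I : Type} [Fintype I] [DecidableEq I] (S : Matrix I I ℝ)
    (hS : S ∈ Matrix.rowStochastic ℝ I) (β : ℝ) (h0 : 0 ≤ β) (h1 : β < 1) (v : I → ℝ)
    (hv : ∀ p, v p = β * ∑ q, S p q * v q) : v = 0 := by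
  rw [Matrix.mem_rowStochastic_iff_sum] at hS
  obtain ⟨hn, hs⟩ := hS
  have key : ‖v‖ ≤ β * ‖v‖ := by
    rw [pi_norm_le_iff_of_nonneg (by positivity)]
    intro p
    rw [hv p, norm_mul, Real.norm_of_nonneg h0]
    refine mul_le_mul_of_nonneg_left ?_ h0
    calc ‖∑ q, S p q * v q‖ ≤ ∑ q, S p q * ‖v‖ := by
          refine norm_sum_le_of_le _ fun q _ => ?_
          rw [norm_mul, Real.norm_of_nonneg (hn p q)]
          exact mul_le_mul_of_nonneg_left (norm_le_pi_norm v q) (hn p q)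
      _ = ‖v‖ := by rw [← Finset.sum_mul, hs, one_mul]
  have : ‖v‖ = 0 := by nlinarith [norm_nonneg v]
  exact norm_eq_zero.mp this

lemma visit_rec {X A : Type} [Fintype X] [Fintype A] [DecidableEq X] [DecidableEq A]
    (P : X → A → X → ℝ) (hP0 : ∀ x a x', 0 ≤ P x a x')
    (hP1 : ∀ x a, ∑ x', P x a x' = 1)
    (π : X → A → ℝ) (hπ0 : ∀ x a, 0 ≤ π x a) (hπ1 : ∀ x, ∑ a, π x a = 1)
    (β : ℝ) (h0 : 0 ≤ β) (h1 : β < 1) (p : X × A) (z : X) :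
    visit P π β p.1 p.2 z = (1 - β) * P p.1 p.2 z +
      β * ∑ q, stateActionMatrix P π p q * visit P π β q.1 q.2 z := by
  have hS := sam_mem P hP0 hP1 π hπ0 hπ1
  have hsum : ∀ q : X × A, Summable fun k : ℕ =>
      β ^ k * ∑ a' : A, (stateActionMatrix P π ^ (k + 1)) q (z, a') := by
    intro q
    have hg : Summable fun k : ℕ => β ^ k * (Fintype.card A : ℝ) :=
      (summable_geometric_of_lt_one h0 h1).mul_right _
    refine Summable.of_nonneg_of_le (fun k => ?_) (fun k => ?_) hg
    · exact mul_nonneg (by positivity) (Finset.sum_nonneg fun a _ =>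
        Matrix.nonneg_of_mem_rowStochastic (pow_mem hS _))
    · refine mul_le_mul_of_nonneg_left ?_ (by positivity)
      calc _ ≤ ∑ a' : A, (1 : ℝ) := Finset.sum_le_sum fun a _ =>
            Matrix.le_one_of_mem_rowStochastic (pow_mem hS _)
        _ = _ := by simp
  unfold visit
  rw [(hsum (p.1, p.2)).tsum_eq_zero_add, mul_add]
  congr 1
  · simp [stateActionMatrix, ← Finset.mul_sum, hπ1]
  · have : ∀ k : ℕ, β ^ (k + 1) * ∑ a' : A,
        (stateActionMatrix P π ^ (k + 1 + 1)) (p.1, p.2) (z, a') =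
        ∑ q, β * stateActionMatrix P π p q *
          (β ^ k * ∑ a' : A, (stateActionMatrix P π ^ (k + 1)) q (z, a')) := by
      intro k
      simp_rw [pow_succ' (stateActionMatrix P π) (k + 1), Matrix.mul_apply]
      rw [Finset.sum_comm]
      simp_rw [Finset.mul_sum]
      refine Finset.sum_congr rfl fun q _ => Finset.sum_congr rfl fun b _ => ?_
      ring
    simp_rw [this]
    rw [Summable.tsum_finsetSum fun q _ => (hsum q).mul_left _]
    simp_rw [tsum_mul_left]
    rw [Finset.mul_sum, Finset.mul_sum]
    refine Finset.sum_congr rfl fun q _ => ?_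
    ring

lemma ghm_rec {X A : Type} [Fintype X] [Fintype A] [DecidableEq X] [DecidableEq A]
    (P : X → A → X → ℝ) (hP0 : ∀ x a x', 0 ≤ P x a x')
    (hP1 : ∀ x a, ∑ x', P x a x' = 1)
    (π : X → A → ℝ) (hπ0 : ∀ x a, 0 ≤ π x a) (hπ1 : ∀ x, ∑ a, π x a = 1)
    (β : ℝ) (h0 : 0 ≤ β) (h1 : β < 1) :
    ghmKernel P π β = (1 - β) • stateActionMatrix P π +
      β • (stateActionMatrix P π * ghmKernel P π β) := by
  ext p q
  simp only [Matrix.add_apply, Matrix.smul_apply, Matrix.mul_apply, smul_eq_mul]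
  simp only [ghmKernel, Matrix.of_apply]
  rw [visit_rec P hP0 hP1 π hπ0 hπ1 β h0 h1 p q.1, add_mul]
  congr 1
  · simp [stateActionMatrix, mul_assoc]
  · rw [mul_assoc, Finset.sum_mul]
    simp only [mul_assoc]

lemma ghm_two {X A : Type} [Fintype X] [Fintype A] [DecidableEq X] [DecidableEq A]
    (P : X → A → X → ℝ) (hP0 : ∀ x a x', 0 ≤ P x a x')
    (hP1 : ∀ x a, ∑ x', P x a x' = 1)
    (π : X → A → ℝ) (hπ0 : ∀ x a, 0 ≤ π x a) (hπ1 : ∀ x, ∑ a, π x a = 1)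
    (β γ : ℝ) (h0 : 0 ≤ β) (h1 : β < 1) (g0 : 0 ≤ γ) (g1 : γ < 1) :
    ghmKernel P π γ = ((1 - γ) / (1 - β)) • ghmKernel P π β +
      ((γ - β) / (1 - β)) • (ghmKernel P π β * ghmKernel P π γ) := by
  have hS := sam_mem P hP0 hP1 π hπ0 hπ1
  have eb := ghm_rec P hP0 hP1 π hπ0 hπ1 β h0 h1
  have eg := ghm_rec P hP0 hP1 π hπ0 hπ1 γ g0 g1
  set S := stateActionMatrix P π
  set K := ghmKernel P π β
  set L := ghmKernel P π γ
  have hne : (1 - β) ≠ 0 := by linarith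
  have hD : L - (((1 - γ) / (1 - β)) • K + ((γ - β) / (1 - β)) • (K * L)) =
      β • (S * (L - (((1 - γ) / (1 - β)) • K + ((γ - β) / (1 - β)) • (K * L)))) := by
    have eKL : K * L = (1 - β) • (S * L) + β • (S * (K * L)) := by
      conv_lhs => rw [eb]
      simp [add_mul, mul_assoc]
    have e1 : ∀ i j, L i j = (1 - γ) * S i j + γ * (S * L) i j := fun i j => by
      conv_lhs => rw [eg]
      simp
    have e2 : ∀ i j, K i j = (1 - β) * S i j + β * (S * K) i j := fun i j => by
      conv_lhs => rw [eb]
      simp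
    have e3 : ∀ i j, (K * L) i j = (1 - β) * (S * L) i j + β * (S * (K * L)) i j := fun i j => by
      conv_lhs => rw [eKL]
      simp
    ext i j
    simp only [mul_sub, mul_add, Matrix.mul_smul, Matrix.sub_apply, Matrix.add_apply,
      Matrix.smul_apply, smul_eq_mul]
    rw [e1, e2, e3]
    field_simp
    ring
  rw [← sub_eq_zero]
  set D := L - (((1 - γ) / (1 - β)) • K + ((γ - β) / (1 - β)) • (K * L))
  ext i j
  have := stoch_inj S hS β h0 h1 (fun i => D i j) (fun p => by
    have := congrFun (congrFun hD p) j
    rw [Matrix.smul_apply, Matrix.mul_apply] at this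
    exact this)
  exact congrFun this i

lemma ghm_avg {X A : Type} [Fintype X] [Fintype A] [DecidableEq X] [DecidableEq A]
    (P : X → A → X → ℝ) (r : X → A → ℝ) (π : X → A → ℝ) (β : ℝ) (p : X × A) :
    ∑ z, visit P π β p.1 p.2 z * ∑ b, π z b * r z b =
      (ghmKernel P π β).mulVec (fun q => r q.1 q.2) p := by
  simp [Matrix.mulVec, dotProduct, ghmKernel, Fintype.sum_prod_type, Finset.mul_sum, mul_assoc]

lemma ghm_avg' {X A : Type} [Fintype X] [Fintype A] [DecidableEq X] [DecidableEq A]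
    (P : X → A → X → ℝ) (r : X → A → ℝ) (π : X → A → ℝ) (hπ1 : ∀ x, ∑ a, π x a = 1) (β : ℝ) :
    (ghmKernel P π β).mulVec (fun q => ∑ b, π q.1 b * r q.1 b) =
      (ghmKernel P π β).mulVec (fun q => r q.1 q.2) := by
  ext p
  rw [← ghm_avg]
  simp only [Matrix.mulVec, dotProduct, ghmKernel, Fintype.sum_prod_type, Matrix.of_apply]
  refine Finset.sum_congr rfl fun z _ => ?_
  rw [← Finset.sum_mul, ← Finset.mul_sum, hπ1, mul_one]

/-- **Composed-model evaluation of a Markov policy.**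
For a finite MDP with discount `γ ∈ (0,1)`, Markov policy `π`, `n ≥ 1`, `0 ≤ β < γ`,
the value `Q^π_γ(x,a)` equals
`r(x,a) + γ/(1-γ) [ ∑_{m=1}^{n-1} ((1-γ)/(1-β)) ((γ-β)/(1-β))^{m-1} E[r^π(X^{(m)})]
  + ((γ-β)/(1-β))^{n-1} E[r^π(X')] ]`,
where `(X^{(m)}, A^{(m)})` is the chain that starts at `(x,a)`, moves between state-action
pairs via `μ^π_β` followed by `π` (so its law is the row of `ghmKernel^m`), and `X'` is
drawn from `μ^π_γ(·|X^{(n-1)}, A^{(n-1)})`; `r^π(x) = ∑_a π(a|x) r(x,a)`. -/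
theorem composed_model_evaluation
    {X A : Type} [Fintype X] [Fintype A] [DecidableEq X] [DecidableEq A]
    [Nonempty X] [Nonempty A]
    (P : X → A → X → ℝ) (hP0 : ∀ x a x', 0 ≤ P x a x')
    (hP1 : ∀ x a, ∑ x', P x a x' = 1)
    (r : X → A → ℝ) (γ : ℝ) (hγ0 : 0 < γ) (hγ1 : γ < 1)
    (β : ℝ) (hβ0 : 0 ≤ β) (hβγ : β < γ)
    (n : ℕ) (hn : 1 ≤ n)
    (π : X → A → ℝ) (hπ0 : ∀ x a, 0 ≤ π x a) (hπ1 : ∀ x, ∑ a, π x a = 1)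
    (Q : X → A → ℝ)
    (hQ : ∀ x a, Q x a =
      r x a + γ * ∑ x', P x a x' * ∑ a', π x' a' * Q x' a')
    (x : X) (a : A) :
    Q x a = r x a + γ / (1 - γ) *
      ((∑ m ∈ Finset.range (n - 1),
          (1 - γ) / (1 - β) * ((γ - β) / (1 - β)) ^ m *
            ∑ q : X × A, (ghmKernel P π β ^ (m + 1)) (x, a) q *
              ∑ b, π q.1 b * r q.1 b)
        + ((γ - β) / (1 - β)) ^ (n - 1) *
          ∑ p : X × A, (ghmKernel P π β ^ (n - 1)) (x, a) p *
            ∑ z, visit P π γ p.1 p.2 z * ∑ b, π z b * r z b) := by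
  have hS := sam_mem P hP0 hP1 π hπ0 hπ1
  have hβ1 : β < 1 := hβγ.trans hγ1
  have eg := ghm_rec P hP0 hP1 π hπ0 hπ1 γ hγ0.le hγ1
  have two := ghm_two P hP0 hP1 π hπ0 hπ1 β γ hβ0 hβ1 hγ0.le hγ1
  have avg' := ghm_avg' P r π hπ1 β
  simp_rw [ghm_avg]
  have hm : ∀ m : ℕ, ∑ q : X × A, (ghmKernel P π β ^ (m + 1)) (x, a) q *
      ∑ b, π q.1 b * r q.1 b =
      (ghmKernel P π β ^ (m + 1)).mulVec (fun q => r q.1 q.2) (x, a) := by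
    intro m
    rw [pow_succ, ← Matrix.mulVec_mulVec, ← avg', Matrix.mulVec_mulVec]
    rfl
  simp_rw [hm]
  have hlast : ∀ N : ℕ, ∑ p : X × A, (ghmKernel P π β ^ N) (x, a) p *
      (ghmKernel P π γ).mulVec (fun q => r q.1 q.2) p =
      (ghmKernel P π β ^ N * ghmKernel P π γ).mulVec (fun q => r q.1 q.2) (x, a) := by
    intro N
    rw [← Matrix.mulVec_mulVec]
    rfl
  rw [hlast]
  set S := stateActionMatrix P π
  set K := ghmKernel P π β
  set L := ghmKernel P π γ
  set R : X × A → ℝ := fun q => r q.1 q.2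
  have hne : (1 - γ) ≠ 0 := by linarith
  have hq : (fun p : X × A => Q p.1 p.2 - (r p.1 p.2 + γ / (1 - γ) * L.mulVec R p)) = 0 := by
    apply stoch_inj S hS γ hγ0.le hγ1
    intro p
    have e1 : ∑ q, S p q * (Q q.1 q.2 - (r q.1 q.2 + γ / (1 - γ) * L.mulVec R q)) =
        (∑ q, S p q * Q q.1 q.2) - S.mulVec R p - γ / (1 - γ) * (S * L).mulVec R p := by
      rw [← Matrix.mulVec_mulVec]
      simp only [Matrix.mulVec, dotProduct, Finset.mul_sum (a := γ / (1 - γ)) ]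
      simp only [← Finset.sum_sub_distrib, R]
      refine Finset.sum_congr rfl fun q _ => ?_
      simp only [← Finset.mul_sum]
      ring
    have e2 : ∑ q, S p q * Q q.1 q.2 =
        ∑ x', P p.1 p.2 x' * ∑ a', π x' a' * Q x' a' := by
      simp [S, stateActionMatrix, Fintype.sum_prod_type, Finset.mul_sum, mul_assoc]
    have e3 : L.mulVec R p = (1 - γ) * S.mulVec R p + γ * (S * L).mulVec R p := by
      conv_lhs => rw [eg]
      simp [Matrix.add_mulVec, Matrix.smul_mulVec]
    rw [e1, e2, e3]
    rw [hQ p.1 p.2]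
    field_simp
    ring
  have hq' := sub_eq_zero.mp (congrFun hq (x, a))
  dsimp only at hq'
  rw [hq']
  congr 2
  generalize n - 1 = N
  induction N with
  | zero => simp
  | succ N ih =>
    rw [ih, Finset.sum_range_succ, add_assoc]
    congr 1
    have e4 : K ^ N * L = ((1 - γ) / (1 - β)) • K ^ (N + 1) +
        ((γ - β) / (1 - β)) • (K ^ (N + 1) * L) := by
      conv_lhs => rw [two]
      rw [mul_add, Matrix.mul_smul, Matrix.mul_smul, ← mul_assoc, ← pow_succ]
    rw [e4]
    simp only [Matrix.add_mulVec, Matrix.smul_mulVec, Pi.add_apply, Pi.smul_apply, smul_eq_mul]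
    ring
end

section
/- Evaluation of geometric switching policies via composed geometric horizon models (state-dependent rewards). Let a finite MDP with discount factor γ ∈ (0,1) be given whose reward function depends only on the state, r : X → ℝ. Fix a switching probability α ∈ (0,1], set β = γ(1-α), let ν = π₁ →α ⋯ →α πₙ be a geometric switching policy, and fix (x,a). Define a joint distribution over (X^{(1)},A^{(1)},…,X^{(n-1)},A^{(n-1)},X') by: (X^{(0)},A^{(0)}) = (x,a); for m = 1,…,n-1, X^{(m)} given (X^{(m-1)},A^{(m-1)}) has law μ^{π_m}_β(·|X^{(m-1)},A^{(m-1)}) and A^{(m)} given X^{(m)} has law π_{m+1}(·|X^{(m)}); and X' given (X^{(n-1)},A^{(n-1)}) has law μ^{πₙ}_γ(·|X^{(n-1)},A^{(n-1)}). Then Q^ν_γ(x,a) = r(x) + (γ/(1-γ)) [ ∑_{m=1}^{n-1} ((1-γ)/(1-β)) ((γ-β)/(1-β))^{m-1} E[r(X^{(m)})] + ((γ-β)/(1-β))^{n-1} E[r(X')] ], where all expectations are finite sums over the joint distribution. -/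
open scoped BigOperators

/-- The law of `(X^{(m)}, A^{(m)})` in the composed-GHM sampling procedure for the
sequence of policies `πs 0, πs 1, …` (0-indexed, so `πs (m-1) = π_m`), started from
`(x,a) = (X^{(0)}, A^{(0)})`:  `X^{(m+1)} ∼ μ^{πs m}_β(·|X^{(m)},A^{(m)})` and
`A^{(m+1)} ∼ (πs (m+1))(·|X^{(m+1)})`. -/
noncomputable def marginal {X A : Type} [Fintype X] [Fintype A] [DecidableEq X] [DecidableEq A]
    (P : X → A → X → ℝ) (β : ℝ) (πs : ℕ → X → A → ℝ) (x : X) (a : A) :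
    ℕ → X × A → ℝ
  | 0 => fun q => if q = (x, a) then 1 else 0
  | m + 1 => fun q =>
      ∑ p : X × A,
        marginal P β πs x a m p * visit P (πs m) β p.1 p.2 q.1 * πs (m + 1) q.1 q.2

lemma gsp_sam_mem {X A : Type} [Fintype X] [Fintype A] [DecidableEq X] [DecidableEq A]
    (P : X → A → X → ℝ) (hP0 : ∀ x a x', 0 ≤ P x a x')
    (hP1 : ∀ x a, ∑ x', P x a x' = 1) (π : X → A → ℝ)
    (h0 : ∀ x a, 0 ≤ π x a) (h1 : ∀ x, ∑ a, π x a = 1) :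
    stateActionMatrix P π ∈ Matrix.rowStochastic ℝ (X × A) := by
  rw [Matrix.mem_rowStochastic_iff_sum]
  refine ⟨fun p q => mul_nonneg (hP0 _ _ _) (h0 _ _), fun p => ?_⟩
  simp only [stateActionMatrix, Matrix.of_apply, Fintype.sum_prod_type, ← Finset.mul_sum, h1,
    mul_one, hP1]

lemma gsp_visit {X A : Type} [Fintype X] [Fintype A] [DecidableEq X] [DecidableEq A]
    (P : X → A → X → ℝ) (hP0 : ∀ x a x', 0 ≤ P x a x')
    (hP1 : ∀ x a, ∑ x', P x a x' = 1) (π : X → A → ℝ)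
    (h0 : ∀ x a, 0 ≤ π x a) (h1 : ∀ x, ∑ a, π x a = 1)
    (β : ℝ) (hb0 : 0 ≤ β) (hb1 : β < 1) (f : X → ℝ) (D : X × A → ℝ)
    (hD : ∀ p, D p = β * ∑ x', P p.1 p.2 x' * ∑ a', π x' a' * D (x', a')
      + ∑ x', P p.1 p.2 x' * f x') (p : X × A) :
    ∑ z, visit P π β p.1 p.2 z * f z = (1 - β) * D p := by
  set S := stateActionMatrix P π with hS
  have hmem : ∀ k, S ^ k ∈ Matrix.rowStochastic ℝ (X × A) := fun k =>
    pow_mem (gsp_sam_mem P hP0 hP1 π h0 h1) k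
  have hnn : ∀ k q, 0 ≤ (S ^ k) p q := fun k q =>
    (Matrix.mem_rowStochastic_iff_sum.1 (hmem k)).1 p q
  have hle : ∀ k q, (S ^ k) p q ≤ 1 := fun k q => by
    rw [← (Matrix.mem_rowStochastic_iff_sum.1 (hmem k)).2 p]
    exact Finset.single_le_sum (f := fun q => (S ^ k) p q) (fun i _ => hnn k i) (Finset.mem_univ q)
  have hgeo := summable_geometric_of_lt_one hb0 hb1
  have hsum : ∀ q, Summable fun k : ℕ => β ^ k * (S ^ (k + 1)) p q := fun q =>
    Summable.of_nonneg_of_le (fun k => mul_nonneg (pow_nonneg hb0 k) (hnn _ q))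
      (fun k => mul_le_of_le_one_right (pow_nonneg hb0 k) (hle _ q)) hgeo
  have hsum2 : ∀ z, Summable fun k : ℕ => β ^ k * ∑ a', (S ^ (k + 1)) p (z, a') := fun z => by
    simp only [Finset.mul_sum]
    exact summable_sum fun a' _ => hsum (z, a')
  -- vector form
  have hDv : D = β • (S.mulVec D) + S.mulVec (fun q => f q.1) := by
    funext q
    rw [hD q]
    simp only [Pi.add_apply, Pi.smul_apply, smul_eq_mul, Matrix.mulVec, dotProduct, hS,
      stateActionMatrix, Matrix.of_apply, Fintype.sum_prod_type, mul_assoc, ← Finset.mul_sum,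
      ← Finset.sum_mul, h1, one_mul]
  have hterm : ∀ k : ℕ, β ^ k * ∑ q : X × A, (S ^ (k + 1)) p q * f q.1
      = β ^ k * ((S ^ k).mulVec D) p - β ^ (k + 1) * ((S ^ (k + 1)).mulVec D) p := fun k => by
    have e : (S ^ k).mulVec D = β • ((S ^ (k + 1)).mulVec D)
        + (S ^ (k + 1)).mulVec (fun q => f q.1) := by
      conv_lhs => rw [hDv]
      rw [Matrix.mulVec_add, Matrix.mulVec_smul, Matrix.mulVec_mulVec, Matrix.mulVec_mulVec,
        ← pow_succ]
    have e2 := congrFun e p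
    simp only [Pi.add_apply, Pi.smul_apply, smul_eq_mul] at e2
    rw [e2]
    simp only [Matrix.mulVec, dotProduct]
    ring
  have hlim : Filter.Tendsto (fun k : ℕ => β ^ k * ((S ^ k).mulVec D) p) Filter.atTop
      (nhds 0) := by
    have hs : Summable fun k : ℕ => β ^ k * ((S ^ k).mulVec D) p := by
      simp only [Matrix.mulVec, dotProduct, Finset.mul_sum, ← mul_assoc]
      refine summable_sum fun q _ => Summable.mul_right _ ?_
      exact Summable.of_nonneg_of_le (fun k => mul_nonneg (pow_nonneg hb0 k) (hnn _ q))
        (fun k => mul_le_of_le_one_right (pow_nonneg hb0 k) (hle _ q)) hgeo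
    exact hs.tendsto_atTop_zero
  have hs3 : ∀ z, Summable fun k : ℕ => (β ^ k * ∑ a', (S ^ (k + 1)) p (z, a')) * f z :=
    fun z => (hsum2 z).mul_right _
  have hre : ∀ k : ℕ, ∑ z, (β ^ k * ∑ a', (S ^ (k + 1)) p (z, a')) * f z
      = β ^ k * ∑ q : X × A, (S ^ (k + 1)) p q * f q.1 := fun k => by
    simp only [Fintype.sum_prod_type, Finset.mul_sum, Finset.sum_mul, mul_assoc]
  have key : HasSum (fun k : ℕ => ∑ z, (β ^ k * ∑ a', (S ^ (k + 1)) p (z, a')) * f z) (D p) := by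
    have hs4 : Summable (fun k : ℕ => ∑ z, (β ^ k * ∑ a', (S ^ (k + 1)) p (z, a')) * f z) :=
      summable_sum fun z _ => hs3 z
    rw [hs4.hasSum_iff_tendsto_nat]
    simp only [hre, hterm]
    simp only [Finset.sum_range_sub']
    simpa using (tendsto_const_nhds (x := D p)).sub hlim
  calc ∑ z, visit P π β p.1 p.2 z * f z
      = (1 - β) * ∑ z, ∑' k : ℕ, (β ^ k * ∑ a', (S ^ (k + 1)) p (z, a')) * f z := by
        rw [Finset.mul_sum]
        refine Finset.sum_congr rfl fun z _ => ?_
        rw [tsum_mul_right, visit, mul_assoc]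
    _ = (1 - β) * D p := by
        rw [← Summable.tsum_finsetSum fun z _ => hs3 z, key.tsum_eq]

lemma gsp_marg {X A : Type} [Fintype X] [Fintype A] [DecidableEq X] [DecidableEq A]
    (P : X → A → X → ℝ) (β : ℝ) (πs : ℕ → X → A → ℝ) (x : X) (a : A) (m : ℕ) (h : X × A → ℝ) :
    ∑ q, marginal P β πs x a (m + 1) q * h q = ∑ p, marginal P β πs x a m p *
      ∑ z, visit P (πs m) β p.1 p.2 z * ∑ a', πs (m + 1) z a' * h (z, a') := by
  simp only [marginal, Finset.sum_mul]
  rw [Finset.sum_comm]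
  refine Finset.sum_congr rfl fun p _ => ?_
  simp only [Fintype.sum_prod_type, Finset.mul_sum, mul_assoc]

/-- **Evaluation of geometric switching policies via composed geometric horizon models
(state-dependent rewards).**  For a finite MDP with discount `γ ∈ (0,1)` and reward
depending only on the state, switching probability `α ∈ (0,1]`, `β = γ(1-α)`, and the
geometric switching policy `ν = π₁ →α ⋯ →α πₙ` (policies `πs 0, …, πs (n-1)`, with
Q-functions `Qs m` of the suffix GSPs characterised by the recursive fixed-point
equations), the value `Qs 0 x a = Q^ν_γ(x,a)` equals
`r(x) + γ/(1-γ) [ ∑_{m=1}^{n-1} ((1-γ)/(1-β)) ((γ-β)/(1-β))^{m-1} E[r(X^{(m)})]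
  + ((γ-β)/(1-β))^{n-1} E[r(X')] ]`. -/
theorem gsp_evaluation_state_rewards
    {X A : Type} [Fintype X] [Fintype A] [DecidableEq X] [DecidableEq A]
    [Nonempty X] [Nonempty A]
    (P : X → A → X → ℝ) (hP0 : ∀ x a x', 0 ≤ P x a x')
    (hP1 : ∀ x a, ∑ x', P x a x' = 1)
    (r : X → ℝ) (γ α : ℝ) (hγ0 : 0 < γ) (hγ1 : γ < 1) (hα0 : 0 < α) (hα1 : α ≤ 1)
    (β : ℝ) (hβ : β = γ * (1 - α))
    (n : ℕ) (hn : 1 ≤ n)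
    (πs : ℕ → X → A → ℝ)
    (hπ0 : ∀ m x a, 0 ≤ πs m x a) (hπ1 : ∀ m x, ∑ a, πs m x a = 1)
    (Qs : ℕ → X → A → ℝ)
    (hQlast : ∀ x a, Qs (n - 1) x a =
      r x + γ * ∑ x', P x a x' * ∑ a', πs (n - 1) x' a' * Qs (n - 1) x' a')
    (hQstep : ∀ m, m + 1 < n → ∀ x a, Qs m x a =
      r x + γ * ∑ x', P x a x' *
        ((1 - α) * ∑ a', πs m x' a' * Qs m x' a'
          + α * ∑ a', πs (m + 1) x' a' * Qs (m + 1) x' a'))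
    (x : X) (a : A) :
    Qs 0 x a = r x + γ / (1 - γ) *
      ((∑ m ∈ Finset.range (n - 1),
          (1 - γ) / (1 - β) * ((γ - β) / (1 - β)) ^ m *
            ∑ q : X × A, marginal P β πs x a (m + 1) q * r q.1)
        + ((γ - β) / (1 - β)) ^ (n - 1) *
          ∑ p : X × A, marginal P β πs x a (n - 1) p *
            ∑ z, visit P (πs (n - 1)) γ p.1 p.2 z * r z) := by
  have hb0 : 0 ≤ β := by rw [hβ]; exact mul_nonneg hγ0.le (by linarith)
  have hb1 : β < 1 := by rw [hβ]; nlinarith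
  have hb : (1 - β) ≠ 0 := by linarith
  have hg : (1 - γ) ≠ 0 := by linarith
  have hlast : ∀ p : X × A, ∑ z, visit P (πs (n - 1)) γ p.1 p.2 z * (γ * r z)
      = (1 - γ) * (Qs (n - 1) p.1 p.2 - r p.1) := by
    refine gsp_visit P hP0 hP1 _ (hπ0 _) (hπ1 _) γ hγ0.le hγ1 _
      (fun p => Qs (n - 1) p.1 p.2 - r p.1) fun p => ?_
    simp only [mul_sub, Finset.sum_sub_distrib, ← Finset.sum_mul, hπ1, one_mul]
    rw [hQlast p.1 p.2]
    simp only [mul_left_comm _ γ, ← Finset.mul_sum]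
    ring
  have hstep : ∀ m, m + 1 < n → ∀ p : X × A,
      ∑ z, visit P (πs m) β p.1 p.2 z *
        (γ * r z + (γ - β) * ∑ a', πs (m + 1) z a' * (Qs (m + 1) z a' - r z))
      = (1 - β) * (Qs m p.1 p.2 - r p.1) := by
    intro m hm
    refine gsp_visit P hP0 hP1 _ (hπ0 _) (hπ1 _) β hb0 hb1 _
      (fun p => Qs m p.1 p.2 - r p.1) fun p => ?_
    simp only [mul_sub, Finset.sum_sub_distrib, ← Finset.sum_mul, hπ1, one_mul]
    rw [hQstep m hm p.1 p.2, add_sub_cancel_left]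
    simp only [← Finset.sum_sub_distrib, ← mul_sub, Finset.mul_sum (s := (Finset.univ : Finset X)),
      ← Finset.sum_add_distrib]
    refine Finset.sum_congr rfl fun z _ => ?_
    rw [hβ]
    ring
  have main : ∀ j, j ≤ n - 1 → Qs 0 x a = r x +
      ((∑ m ∈ Finset.range j, γ / (1 - β) * ((γ - β) / (1 - β)) ^ m *
            ∑ q : X × A, marginal P β πs x a (m + 1) q * r q.1)
        + ((γ - β) / (1 - β)) ^ j *
          ∑ p : X × A, marginal P β πs x a j p * (Qs j p.1 p.2 - r p.1)) := by
    intro j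
    induction j with
    | zero => intro _; simp [marginal]
    | succ j ih =>
      intro hj
      rw [ih (by omega), Finset.sum_range_succ, add_assoc (Finset.sum _ _)]
      congr 2
      have e : ∑ p : X × A, marginal P β πs x a j p * (Qs j p.1 p.2 - r p.1)
          = γ / (1 - β) * ∑ q : X × A, marginal P β πs x a (j + 1) q * r q.1
            + (γ - β) / (1 - β) * ∑ q : X × A, marginal P β πs x a (j + 1) q *
              (Qs (j + 1) q.1 q.2 - r q.1) := by
        rw [gsp_marg P β πs x a j (fun q => r q.1),
          gsp_marg P β πs x a j (fun q => Qs (j + 1) q.1 q.2 - r q.1),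
          Finset.mul_sum, Finset.mul_sum, ← Finset.sum_add_distrib]
        refine Finset.sum_congr rfl fun p _ => ?_
        have h := hstep j (by omega) p
        have h2 : Qs j p.1 p.2 - r p.1 = (1 - β)⁻¹ * ∑ z, visit P (πs j) β p.1 p.2 z *
            (γ * r z + (γ - β) * ∑ a', πs (j + 1) z a' * (Qs (j + 1) z a' - r z)) := by
          rw [h]; field_simp
        rw [h2]
        simp only [← Finset.sum_mul, hπ1, one_mul, mul_add, Finset.sum_add_distrib,
          mul_left_comm _ γ, mul_left_comm _ (γ - β), ← Finset.mul_sum]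
        ring
      rw [e, pow_succ]
      ring
  rw [main (n - 1) le_rfl, mul_add]
  congr 2
  · rw [Finset.mul_sum]
    refine Finset.sum_congr rfl fun m _ => ?_
    field_simp
  · rw [mul_left_comm]
    congr 1
    rw [Finset.mul_sum]
    refine Finset.sum_congr rfl fun p _ => ?_
    have h := hlast p
    simp only [mul_left_comm _ γ, ← Finset.mul_sum] at h
    rw [mul_left_comm]
    congr 1
    field_simp
    linarith
end

section
/- Weighted-L² contractivity of the distributional Bellman operator under a stationary distribution. Let a finite MDP be given, let π be a Markov policy, let γ ∈ [0,1), and let ξ be a probability distribution on X × A that is stationary for the state-action transition matrix S^π, i.e. ∑_{(x,a)} ξ(x,a) S^π((x,a),(x',a')) = ξ(x',a') for all (x',a'). Define ‖μ‖²_ξ = ∑_{(x,a,x')} ξ(x,a) μ(x'|x,a)² and the operator (T^π_γ μ)(x'|x,a) = (1-γ) P(x'|x,a) + γ ∑_{x''} ∑_{a''} P(x''|x,a) π(a''|x'') μ(x'|x'',a''). Then for all μ, μ' : X × A × X → ℝ, ‖T^π_γ μ - T^π_γ μ'‖_ξ ≤ γ ‖μ - μ'‖_ξ. -/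
open scoped BigOperators

/-- The distributional Bellman operator
`(T^π_γ μ)(x'|x,a) = (1-γ) P(x'|x,a) + γ ∑_{x''} ∑_{a''} P(x''|x,a) π(a''|x'') μ(x'|x'',a'')`. -/
def distBellman {X A : Type} [Fintype X] [Fintype A]
    (P : X → A → X → ℝ) (π : X → A → ℝ) (γ : ℝ)
    (μ : X → A → X → ℝ) : X → A → X → ℝ :=
  fun x a x' => (1 - γ) * P x a x' +
    γ * ∑ x'' : X, ∑ a'' : A, P x a x'' * π x'' a'' * μ x'' a'' x'

/-- The weighted `L²` norm `‖μ‖_ξ = sqrt (∑_{(x,a,x')} ξ(x,a) μ(x'|x,a)²)`. -/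
noncomputable def xiNorm {X A : Type} [Fintype X] [Fintype A]
    (ξ : X × A → ℝ) (μ : X → A → X → ℝ) : ℝ :=
  Real.sqrt (∑ p : X × A, ∑ x' : X, ξ p * (μ p.1 p.2 x') ^ 2)

/-- **Weighted-`L²` contractivity of the distributional Bellman operator under a
stationary distribution**:  if `ξ` is a probability distribution on `X × A` stationary for
the state-action transition matrix `S^π`, then
`‖T^π_γ μ - T^π_γ μ'‖_ξ ≤ γ ‖μ - μ'‖_ξ` for all `μ, μ'`. -/
theorem distBellman_weightedL2_contraction
    {X A : Type} [Fintype X] [Fintype A] [Nonempty X] [Nonempty A]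
    (P : X → A → X → ℝ) (hP0 : ∀ x a x', 0 ≤ P x a x')
    (hP1 : ∀ x a, ∑ x', P x a x' = 1)
    (π : X → A → ℝ) (hπ0 : ∀ x a, 0 ≤ π x a) (hπ1 : ∀ x, ∑ a, π x a = 1)
    (γ : ℝ) (hγ0 : 0 ≤ γ) (hγ1 : γ < 1)
    (ξ : X × A → ℝ) (hξ0 : ∀ p, 0 ≤ ξ p) (hξ1 : ∑ p : X × A, ξ p = 1)
    (hξstat : ∀ q : X × A,
      ∑ p : X × A, ξ p * (P p.1 p.2 q.1 * π q.1 q.2) = ξ q)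
    (μ μ' : X → A → X → ℝ) :
    xiNorm ξ (fun x a x' => distBellman P π γ μ x a x' - distBellman P π γ μ' x a x')
      ≤ γ * xiNorm ξ (fun x a x' => μ x a x' - μ' x a x') := by
  have hdiff : ∀ x a x', distBellman P π γ μ x a x' - distBellman P π γ μ' x a x'
      = γ * ∑ q : X × A, P x a q.1 * π q.1 q.2 * (μ q.1 q.2 x' - μ' q.1 q.2 x') := by
    intro x a x'
    simp only [distBellman, Fintype.sum_prod_type, mul_sub, Finset.sum_sub_distrib]
    ring
  have hw1 : ∀ x a, ∑ q : X × A, P x a q.1 * π q.1 q.2 = 1 := by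
    intro x a
    simp only [Fintype.sum_prod_type, ← Finset.mul_sum, hπ1, mul_one, hP1]
  have hJ : ∀ x a x', (∑ q : X × A, P x a q.1 * π q.1 q.2 * (μ q.1 q.2 x' - μ' q.1 q.2 x')) ^ 2
      ≤ ∑ q : X × A, P x a q.1 * π q.1 q.2 * (μ q.1 q.2 x' - μ' q.1 q.2 x') ^ 2 := by
    intro x a x'
    have h := (even_two.convexOn_pow (𝕜 := ℝ)).map_sum_le (t := Finset.univ)
      (w := fun q : X × A => P x a q.1 * π q.1 q.2)
      (p := fun q : X × A => μ q.1 q.2 x' - μ' q.1 q.2 x')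
      (fun q _ => mul_nonneg (hP0 _ _ _) (hπ0 _ _)) (hw1 x a) (fun q _ => Set.mem_univ _)
    simpa only [smul_eq_mul] using h
  unfold xiNorm
  apply Real.sqrt_le_iff.2
  refine ⟨mul_nonneg hγ0 (Real.sqrt_nonneg _), ?_⟩
  rw [mul_pow, Real.sq_sqrt (Finset.sum_nonneg fun p _ => Finset.sum_nonneg fun x' _ =>
    mul_nonneg (hξ0 p) (sq_nonneg _))]
  simp only [hdiff]
  calc ∑ p : X × A, ∑ x' : X, ξ p * (γ * ∑ q : X × A, P p.1 p.2 q.1 * π q.1 q.2 *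
          (μ q.1 q.2 x' - μ' q.1 q.2 x')) ^ 2
      ≤ ∑ p : X × A, ∑ x' : X, γ ^ 2 * ∑ q : X × A, ξ p * (P p.1 p.2 q.1 * π q.1 q.2) *
          (μ q.1 q.2 x' - μ' q.1 q.2 x') ^ 2 := by
        refine Finset.sum_le_sum fun p _ => Finset.sum_le_sum fun x' _ => ?_
        rw [mul_pow, mul_left_comm]
        refine mul_le_mul_of_nonneg_left ?_ (sq_nonneg _)
        refine (mul_le_mul_of_nonneg_left (hJ p.1 p.2 x') (hξ0 p)).trans_eq ?_
        rw [Finset.mul_sum]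
        exact Finset.sum_congr rfl fun q _ => by ring
    _ = γ ^ 2 * ∑ q : X × A, ∑ x' : X, ξ q * (μ q.1 q.2 x' - μ' q.1 q.2 x') ^ 2 := by
        simp only [← Finset.mul_sum]
        congr 1
        calc _ = ∑ p : X × A, ∑ q : X × A, ∑ x' : X, ξ p * (P p.1 p.2 q.1 * π q.1 q.2) *
                (μ q.1 q.2 x' - μ' q.1 q.2 x') ^ 2 :=
              Finset.sum_congr rfl fun p _ => Finset.sum_comm
          _ = _ := by
              rw [Finset.sum_comm]
              refine Finset.sum_congr rfl fun q _ => ?_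
              simp only [← Finset.mul_sum]
              rw [← Finset.sum_mul, hξstat]
end

section
/- Negative-drift inequality for the CETD Lyapunov argument. Let a finite MDP be given, let π be a Markov policy, let γ ∈ [0,1), and let ξ be a probability distribution on X × A that is stationary for the state-action transition matrix S^π, i.e. ∑_{(x,a)} ξ(x,a) S^π((x,a),(x',a')) = ξ(x',a') for all (x',a'). Define the weighted inner product ⟨μ, μ'⟩_ξ = ∑_{(x,a,x')} ξ(x,a) μ(x'|x,a) μ'(x'|x,a) with induced norm ‖·‖_ξ, the operator (T^π_γ μ)(x'|x,a) = (1-γ) P(x'|x,a) + γ ∑_{x''} ∑_{a''} P(x''|x,a) π(a''|x'') μ(x'|x'',a''), and let μ^π_γ be the discounted future state-visitation distribution (the fixed point of T^π_γ). Then for every μ : X × A × X → ℝ, ⟨μ - μ^π_γ, T^π_γ μ - μ⟩_ξ ≤ -((1-γ²)/2) ‖μ^π_γ - μ‖²_ξ. -/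
open scoped BigOperators

/-- The weighted inner product `⟨μ, μ'⟩_ξ = ∑_{(x,a,x')} ξ(x,a) μ(x'|x,a) μ'(x'|x,a)`. -/
def xiInner {X A : Type} [Fintype X] [Fintype A]
    (ξ : X × A → ℝ) (μ μ' : X → A → X → ℝ) : ℝ :=
  ∑ p : X × A, ∑ x' : X, ξ p * μ p.1 p.2 x' * μ' p.1 p.2 x'

section helpers

variable {X A : Type} [Fintype X] [Fintype A] [DecidableEq X] [DecidableEq A]

theorem aux_row (P : X → A → X → ℝ) (hP1 : ∀ x a, ∑ x', P x a x' = 1)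
    (π : X → A → ℝ) (hπ1 : ∀ x, ∑ a, π x a = 1) (p : X × A) :
    ∑ q : X × A, P p.1 p.2 q.1 * π q.1 q.2 = 1 := by
  rw [Fintype.sum_prod_type]
  simp only [← Finset.mul_sum, hπ1, mul_one, hP1]

theorem aux_zero (P : X → A → X → ℝ)
    (π : X → A → ℝ) (hπ1 : ∀ x, ∑ a, π x a = 1) (p : X × A) (x' : X) :
    ∑ a' : A, (stateActionMatrix P π ^ (0 + 1)) p (x', a') = P p.1 p.2 x' := by
  simp [stateActionMatrix, ← Finset.mul_sum, hπ1]

theorem aux_succ (P : X → A → X → ℝ) (π : X → A → ℝ) (k : ℕ) (p : X × A) (x' : X) :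
    ∑ a' : A, (stateActionMatrix P π ^ (k + 1 + 1)) p (x', a') =
      ∑ q : X × A, P p.1 p.2 q.1 * π q.1 q.2 *
        ∑ a' : A, (stateActionMatrix P π ^ (k + 1)) q (x', a') := by
  simp only [Finset.mul_sum]
  rw [Finset.sum_comm]
  refine Finset.sum_congr rfl fun a' _ => ?_
  rw [pow_succ' _ (k + 1), Matrix.mul_apply]
  rfl

theorem aux_bound (P : X → A → X → ℝ) (hP0 : ∀ x a x', 0 ≤ P x a x')
    (hP1 : ∀ x a, ∑ x', P x a x' = 1)
    (π : X → A → ℝ) (hπ0 : ∀ x a, 0 ≤ π x a) (hπ1 : ∀ x, ∑ a, π x a = 1) (k : ℕ)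
    (x' : X) : ∀ p : X × A,
    0 ≤ ∑ a' : A, (stateActionMatrix P π ^ (k + 1)) p (x', a') ∧
    ∑ a' : A, (stateActionMatrix P π ^ (k + 1)) p (x', a') ≤ 1 := by
  induction k with
  | zero =>
    intro p
    rw [aux_zero P π hπ1]
    refine ⟨hP0 _ _ _, ?_⟩
    rw [← hP1 p.1 p.2]
    exact Finset.single_le_sum (f := fun y => P p.1 p.2 y) (fun y _ => hP0 _ _ _)
      (Finset.mem_univ x')
  | succ k ih =>
    intro p
    rw [aux_succ]
    have h0 : ∀ q : X × A, 0 ≤ P p.1 p.2 q.1 * π q.1 q.2 :=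
      fun q => mul_nonneg (hP0 _ _ _) (hπ0 _ _)
    refine ⟨Finset.sum_nonneg fun q _ => mul_nonneg (h0 q) (ih q).1, ?_⟩
    rw [← aux_row P hP1 π hπ1 p]
    exact Finset.sum_le_sum fun q _ => mul_le_of_le_one_right (h0 q) (ih q).2

theorem aux_fix (P : X → A → X → ℝ) (hP0 : ∀ x a x', 0 ≤ P x a x')
    (hP1 : ∀ x a, ∑ x', P x a x' = 1)
    (π : X → A → ℝ) (hπ0 : ∀ x a, 0 ≤ π x a) (hπ1 : ∀ x, ∑ a, π x a = 1)
    (γ : ℝ) (hγ0 : 0 ≤ γ) (hγ1 : γ < 1) (p : X × A) (x' : X) :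
    visit P π γ p.1 p.2 x' = (1 - γ) * P p.1 p.2 x' +
      γ * ∑ q : X × A, P p.1 p.2 q.1 * π q.1 q.2 * visit P π γ q.1 q.2 x' := by
  have hs : ∀ q : X × A, Summable fun k : ℕ =>
      γ ^ k * ∑ a' : A, (stateActionMatrix P π ^ (k + 1)) q (x', a') := by
    intro q
    refine Summable.of_nonneg_of_le (fun k => ?_) (fun k => ?_)
      (summable_geometric_of_lt_one hγ0 hγ1)
    · exact mul_nonneg (pow_nonneg hγ0 k) (aux_bound P hP0 hP1 π hπ0 hπ1 k x' q).1
    · exact mul_le_of_le_one_right (pow_nonneg hγ0 k)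
        (aux_bound P hP0 hP1 π hπ0 hπ1 k x' q).2
  have hsum : ∀ k : ℕ, γ ^ (k + 1) *
      ∑ a' : A, (stateActionMatrix P π ^ (k + 1 + 1)) p (x', a') =
      ∑ q : X × A, γ * (P p.1 p.2 q.1 * π q.1 q.2) *
        (γ ^ k * ∑ a' : A, (stateActionMatrix P π ^ (k + 1)) q (x', a')) := by
    intro k
    rw [aux_succ, Finset.mul_sum]
    refine Finset.sum_congr rfl fun q _ => ?_
    ring
  unfold visit
  rw [(hs p).tsum_eq_zero_add]
  simp only [hsum]
  rw [Summable.tsum_finsetSum (fun q _ => (hs q).mul_left _)]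
  simp only [tsum_mul_left]
  rw [aux_zero P π hπ1, pow_zero, one_mul, mul_add, Finset.mul_sum, Finset.mul_sum]
  congr 1
  refine Finset.sum_congr rfl fun q _ => ?_
  ring

theorem aux_jensen {ι : Type} [Fintype ι] (w f : ι → ℝ) (hw : ∀ i, 0 ≤ w i)
    (h1 : ∑ i, w i = 1) : (∑ i, w i * f i) ^ 2 ≤ ∑ i, w i * f i ^ 2 := by
  have h := Finset.sum_nonneg (s := Finset.univ) (f := fun i => w i * (f i - ∑ j, w j * f j) ^ 2)
    fun i _ => mul_nonneg (hw i) (sq_nonneg _)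
  set m := ∑ j, w j * f j with hm
  have e : ∑ i, w i * (f i - m) ^ 2 = ∑ i, w i * f i ^ 2 - 2 * m * ∑ i, w i * f i
      + m ^ 2 * ∑ i, w i := by
    simp only [Finset.mul_sum]
    rw [← Finset.sum_sub_distrib, ← Finset.sum_add_distrib]
    exact Finset.sum_congr rfl fun i _ => by ring
  rw [e, h1, ← hm] at h
  nlinarith

end helpers

/-- **Negative-drift inequality for the CETD Lyapunov argument**:  if `ξ` is a probability
distribution on `X × A` stationary for `S^π`, then for every `μ : X × A × X → ℝ`,
`⟨μ - μ^π_γ, T^π_γ μ - μ⟩_ξ ≤ -((1-γ²)/2) ‖μ^π_γ - μ‖²_ξ`. -/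
theorem cetd_negative_drift
    {X A : Type} [Fintype X] [Fintype A] [DecidableEq X] [DecidableEq A]
    [Nonempty X] [Nonempty A]
    (P : X → A → X → ℝ) (hP0 : ∀ x a x', 0 ≤ P x a x')
    (hP1 : ∀ x a, ∑ x', P x a x' = 1)
    (π : X → A → ℝ) (hπ0 : ∀ x a, 0 ≤ π x a) (hπ1 : ∀ x, ∑ a, π x a = 1)
    (γ : ℝ) (hγ0 : 0 ≤ γ) (hγ1 : γ < 1)
    (ξ : X × A → ℝ) (hξ0 : ∀ p, 0 ≤ ξ p) (hξ1 : ∑ p : X × A, ξ p = 1)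
    (hξstat : ∀ q : X × A,
      ∑ p : X × A, ξ p * (P p.1 p.2 q.1 * π q.1 q.2) = ξ q)
    (μ : X → A → X → ℝ) :
    xiInner ξ (fun x a x' => μ x a x' - visit P π γ x a x')
        (fun x a x' => distBellman P π γ μ x a x' - μ x a x')
      ≤ -((1 - γ ^ 2) / 2) *
        xiInner ξ (fun x a x' => visit P π γ x a x' - μ x a x')
          (fun x a x' => visit P π γ x a x' - μ x a x') := by
  set v := visit P π γ with hv
  let S : X × A → X × A → ℝ := fun p q => P p.1 p.2 q.1 * π q.1 q.2
  have hS0 : ∀ p q, 0 ≤ S p q := fun p q => mul_nonneg (hP0 _ _ _) (hπ0 _ _)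
  have hS1 : ∀ p, ∑ q, S p q = 1 := aux_row P hP1 π hπ1
  let D : X × A → X → ℝ := fun p y => μ p.1 p.2 y - v p.1 p.2 y
  have hT : ∀ (p : X × A) (y : X), distBellman P π γ μ p.1 p.2 y - μ p.1 p.2 y =
      γ * (∑ q, S p q * D q y) - D p y := by
    intro p y
    have h := aux_fix P hP0 hP1 π hπ0 hπ1 γ hγ0 hγ1 p y
    rw [← hv] at h
    have e : ∑ q, S p q * D q y = ∑ q, S p q * μ q.1 q.2 y - ∑ q, S p q * v q.1 q.2 y := by
      rw [← Finset.sum_sub_distrib]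
      exact Finset.sum_congr rfl fun q _ => by simp only [D]; ring
    have e2 : distBellman P π γ μ p.1 p.2 y =
        (1 - γ) * P p.1 p.2 y + γ * ∑ q, S p q * μ q.1 q.2 y := by
      simp only [distBellman, S, Fintype.sum_prod_type]
    have h' : v p.1 p.2 y = (1 - γ) * P p.1 p.2 y + γ * ∑ q, S p q * v q.1 q.2 y := h
    rw [e, e2]
    simp only [D]
    linarith
  have hJ : ∑ p, ∑ y, ξ p * (∑ q, S p q * D q y) ^ 2 ≤ ∑ p, ∑ y, ξ p * D p y ^ 2 := by
    calc ∑ p, ∑ y, ξ p * (∑ q, S p q * D q y) ^ 2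
        ≤ ∑ p, ∑ y, ξ p * ∑ q, S p q * D q y ^ 2 :=
          Finset.sum_le_sum fun p _ => Finset.sum_le_sum fun y _ =>
            mul_le_mul_of_nonneg_left (aux_jensen _ _ (hS0 p) (hS1 p)) (hξ0 p)
      _ = ∑ y, ∑ q, ∑ p, ξ p * S p q * D q y ^ 2 := by
          rw [Finset.sum_comm]
          refine Finset.sum_congr rfl fun y _ => ?_
          rw [Finset.sum_comm]
          refine Finset.sum_congr rfl fun p _ => ?_
          rw [Finset.mul_sum]
          exact Finset.sum_congr rfl fun q _ => by ring
      _ = ∑ y, ∑ q, ξ q * D q y ^ 2 := by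
          refine Finset.sum_congr rfl fun y _ => Finset.sum_congr rfl fun q _ => ?_
          rw [← Finset.sum_mul, hξstat q]
      _ = ∑ p, ∑ y, ξ p * D p y ^ 2 := Finset.sum_comm
  have hL : xiInner ξ (fun x a x' => μ x a x' - v x a x')
        (fun x a x' => distBellman P π γ μ x a x' - μ x a x') ≤
      ∑ p, ∑ y, (γ ^ 2 / 2 * (ξ p * (∑ q, S p q * D q y) ^ 2) - 1 / 2 * (ξ p * D p y ^ 2)) := by
    unfold xiInner
    refine Finset.sum_le_sum fun p _ => Finset.sum_le_sum fun y _ => ?_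
    simp only [hT]
    change ξ p * D p y * _ ≤ _
    nlinarith [mul_nonneg (hξ0 p) (sq_nonneg (D p y - γ * ∑ q, S p q * D q y))]
  have hR : xiInner ξ (fun x a x' => v x a x' - μ x a x')
          (fun x a x' => v x a x' - μ x a x') = ∑ p, ∑ y, ξ p * D p y ^ 2 := by
    unfold xiInner
    refine Finset.sum_congr rfl fun p _ => Finset.sum_congr rfl fun y _ => ?_
    simp only [D]
    ring
  simp only [Finset.sum_sub_distrib, ← Finset.mul_sum] at hL hR hJ
  rw [hR]
  nlinarith [mul_le_mul_of_nonneg_left hJ (by positivity : (0:ℝ) ≤ γ ^ 2 / 2)]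
end

section
/- Gradient of the Kullback–Leibler divergence to a softmax in the logits. Let ι be a nonempty finite type, let p : ι → ℝ be a probability vector (p_i ≥ 0, ∑_i p_i = 1), and define f : (ι → ℝ) → ℝ by f(φ) = ∑_i p_i (log p_i - log(softmax(φ)_i)), where softmax(φ)_i = exp(φ_i) / ∑_j exp(φ_j) and terms with p_i = 0 are interpreted as 0. Then f is differentiable at every φ, and its gradient is given coordinatewise by ∂f/∂φ_j (φ) = softmax(φ)_j - p_j. -/
open scoped BigOperators

/-- `softmax(φ)_i = exp(φ_i) / ∑_j exp(φ_j)`. -/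
noncomputable def softmax {ι : Type} [Fintype ι] (φ : ι → ℝ) (i : ι) : ℝ :=
  Real.exp (φ i) / ∑ j, Real.exp (φ j)

/-- **Gradient of the Kullback–Leibler divergence to a softmax in the logits.**
For a probability vector `p` on a nonempty finite type `ι`, the function
`f(φ) = KL(p ‖ softmax(φ)) = ∑_i p_i (log p_i - log softmax(φ)_i)` is differentiable at
every `φ`, with gradient given coordinatewise by `∂f/∂φ_j = softmax(φ)_j - p_j`
(the derivative is the continuous linear map `v ↦ ∑_j (softmax(φ)_j - p_j) v_j`). -/
theorem kl_softmax_gradient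
    {ι : Type} [Fintype ι] [Nonempty ι]
    (p : ι → ℝ) (hp0 : ∀ i, 0 ≤ p i) (hp1 : ∑ i, p i = 1) (φ : ι → ℝ) :
    HasFDerivAt
      (fun ψ : ι → ℝ => ∑ i, p i * (Real.log (p i) - Real.log (softmax ψ i)))
      (∑ j : ι, (softmax φ j - p j) •
        (ContinuousLinearMap.proj j : (ι → ℝ) →L[ℝ] ℝ)) φ := by
  have hS : ∀ ψ : ι → ℝ, 0 < ∑ j, Real.exp (ψ j) := fun ψ =>
    Finset.sum_pos (fun j _ => Real.exp_pos _) Finset.univ_nonempty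
  have hf : (fun ψ : ι → ℝ => ∑ i, p i * (Real.log (p i) - Real.log (softmax ψ i)))
      = fun ψ : ι → ℝ => Real.log (∑ j, Real.exp (ψ j))
          + ∑ i, p i * (Real.log (p i) - ψ i) := by
    funext ψ
    have h1 : ∀ i, p i * (Real.log (p i) - Real.log (softmax ψ i))
        = p i * Real.log (∑ j, Real.exp (ψ j)) + p i * (Real.log (p i) - ψ i) := by
      intro i
      rw [softmax, Real.log_div (Real.exp_pos _).ne' (hS ψ).ne', Real.log_exp]
      ring
    rw [Finset.sum_congr rfl (fun i _ => h1 i), Finset.sum_add_distrib, ← Finset.sum_mul,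
      hp1, one_mul]
  rw [hf]
  have hproj : ∀ i : ι, HasFDerivAt (fun ψ : ι → ℝ => ψ i)
      (ContinuousLinearMap.proj i : (ι → ℝ) →L[ℝ] ℝ) φ := fun i =>
    (ContinuousLinearMap.proj i : (ι → ℝ) →L[ℝ] ℝ).hasFDerivAt
  have hA := (HasFDerivAt.fun_sum (u := Finset.univ)
    (fun i _ => (hproj i).exp)).log (hS φ).ne'
  have hB := HasFDerivAt.fun_sum (u := Finset.univ)
    (fun i _ => ((hproj i).const_sub (Real.log (p i))).const_mul (p i))
  refine (hA.add hB).congr_fderiv ?_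
  ext v
  simp only [ContinuousLinearMap.add_apply, ContinuousLinearMap.smul_apply,
    ContinuousLinearMap.sum_apply, ContinuousLinearMap.neg_apply,
    ContinuousLinearMap.proj_apply, smul_eq_mul, Finset.mul_sum]
  rw [← Finset.sum_add_distrib]
  refine Finset.sum_congr rfl fun i _ => ?_
  rw [softmax]
  ring
end

section
/- Powers of the geometric-horizon matrix are negative-binomial mixtures of powers of the transition matrix. Let ι be a nonempty finite type, let S be a row-stochastic ι × ι real matrix (all entries nonnegative, each row summing to 1), and let β ∈ [0,1). Define M = (1-β) ∑_{k≥0} β^k S^{k+1} (the series converges entrywise since the entries of all powers of S lie in [0,1]). Then for every n ≥ 1, M^n = ∑_{t≥n} binom(t-1, n-1) (1-β)^n β^{t-n} S^t, where the series on the right converges entrywise and the coefficients binom(t-1,n-1)(1-β)^n β^{t-n} are the probabilities that a sum of n independent Geometric(1-β) random variables on {1,2,…} equals t. -/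
open scoped BigOperators

attribute [local instance] Matrix.linftyOpNormedRing Matrix.linftyOpNormedAlgebra in
theorem ghm_aux
    {ι : Type} [Fintype ι] [DecidableEq ι]
    (S : Matrix ι ι ℝ) (hS0 : ∀ p q, 0 ≤ S p q) (hS1 : ∀ p, ∑ q, S p q = 1)
    (β : ℝ) (hβ0 : 0 ≤ β) (hβ1 : β < 1) :
    ∃ I : Matrix ι ι ℝ, Commute S I ∧ ∀ k : ℕ, ∀ p q,
      HasSum (fun s : ℕ =>
        ((s + k).choose k : ℝ) * (1 - β) ^ (k + 1) * β ^ s * (S ^ (s + (k + 1))) p q)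
        ((((1 - β) • (S * I)) ^ (k + 1)) p q) := by
  have hS : ‖S‖ ≤ 1 := by
    rw [Matrix.linfty_opNorm_def]
    norm_cast
    refine Finset.sup_le fun i _ => ?_
    rw [← NNReal.coe_le_coe]
    push_cast
    simp only [Real.norm_of_nonneg (hS0 _ _), hS1 i, le_refl]
  have hA : ‖β • S‖ < 1 := by
    rw [norm_smul, Real.norm_of_nonneg hβ0]
    nlinarith
  have hc : Commute S (Ring.inverse (1 - β • S)) := by
    have h0 : Commute S (1 - β • S) := (Commute.one_right S).sub_right ((Commute.refl S).smul_right β)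
    by_cases hu : IsUnit (1 - β • S)
    · obtain ⟨u, hu⟩ := hu
      rw [← hu] at h0 ⊢
      rw [Ring.inverse_unit]
      exact h0.units_inv_right
    · rw [Ring.inverse_non_unit _ hu]
      exact Commute.zero_right S
  refine ⟨Ring.inverse (1 - β • S), hc, fun k p q => ?_⟩
  have h := (hasSum_choose_mul_geometric_of_norm_lt_one' k hA).mul_left
    ((1 - β) ^ (k + 1) • S ^ (k + 1))
  have h2 := (h.map (Matrix.entryAddMonoidHom ℝ p q) (continuous_id.matrix_elem p q))
  convert h2 using 1
  · funext s
    have : ((s + k).choose k : Matrix ι ι ℝ) * (β • S) ^ s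
        = (((s + k).choose k : ℝ) * β ^ s) • S ^ s := by
      rw [← nsmul_eq_mul, ← Nat.cast_smul_eq_nsmul ℝ, smul_pow, smul_smul]
    simp only [Function.comp, this, Matrix.entryAddMonoidHom_apply]
    rw [smul_mul_smul_comm, ← pow_add, Matrix.smul_apply, smul_eq_mul, add_comm s (k + 1)]
    ring
  · rw [smul_pow, hc.mul_pow, Matrix.entryAddMonoidHom_apply, smul_mul_assoc]

/-- **Powers of the geometric-horizon matrix are negative-binomial mixtures of powers of
the transition matrix.**  Let `S` be a row-stochastic matrix over a nonempty finite type
and `β ∈ [0,1)`, and let `M = (1-β) ∑_{k≥0} β^k S^{k+1}` (entrywise).  Then for every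
`n ≥ 1`, entrywise,
`M^n = ∑_{t≥n} binom(t-1, n-1) (1-β)^n β^(t-n) S^t`
(the series, reindexed by `t = s + n`, converges); the coefficients are the probabilities
that a sum of `n` independent `Geometric(1-β)` random variables on `{1,2,…}` equals `t`. -/
theorem ghm_matrix_power_negative_binomial
    {ι : Type} [Fintype ι] [DecidableEq ι] [Nonempty ι]
    (S : Matrix ι ι ℝ) (hS0 : ∀ p q, 0 ≤ S p q) (hS1 : ∀ p, ∑ q, S p q = 1)
    (β : ℝ) (hβ0 : 0 ≤ β) (hβ1 : β < 1)
    (M : Matrix ι ι ℝ)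
    (hM : ∀ p q, M p q = (1 - β) * ∑' k : ℕ, β ^ k * (S ^ (k + 1)) p q) :
    ∀ n, 1 ≤ n → ∀ p q,
      (Summable fun s : ℕ =>
        ((s + n - 1).choose (n - 1) : ℝ) * (1 - β) ^ n * β ^ s * (S ^ (s + n)) p q) ∧
      (M ^ n) p q =
        ∑' s : ℕ,
          ((s + n - 1).choose (n - 1) : ℝ) * (1 - β) ^ n * β ^ s * (S ^ (s + n)) p q := by
  intro n hn p q
  obtain ⟨I, hI, H⟩ := ghm_aux S hS0 hS1 β hβ0 hβ1
  have hMI : M = (1 - β) • (S * I) := by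
    ext a b
    have h := H 0 a b
    rw [zero_add, pow_one, pow_one] at h
    rw [hM, ← tsum_mul_left, ← h.tsum_eq]
    refine tsum_congr fun s => ?_
    simp
    ring
  obtain ⟨k, rfl⟩ : ∃ k, n = k + 1 := ⟨n - 1, by omega⟩
  have h := H k p q
  rw [← hMI] at h
  exact ⟨h.summable, h.tsum_eq.symm⟩
end
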